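/- arXiv:2508.00541 — 2 statements merged into one kernel-verified Lean document; each statement's English description precedes it below -/
import Mathlib

section
/- Let x, q be real numbers with q ≤ x. Then the worst-case expected profit over the mean-MAD ambiguity set satisfies inf { ∫ Π(x, q, y) dQ(y) : Q ∈ 𝒫 } = w_y̲·Π(x, q, y̲) + w_μ·Π(x, q, μ) + w_ȳ·Π(x, q, ȳ), and the infimum is attained by the three-point measure ℙ* := w_y̲·δ_{y̲} + w_μ·δ_{μ} + w_ȳ·δ_{ȳ} (where δ_a denotes the Dirac measure at a). -/
open MeasureTheory

/-- Realized demand: `d_y = (1 - p) * y`. -/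
noncomputable def dem (p y : ℝ) : ℝ := (1 - p) * y

/-- Second-stage (quick-response) production quantity. -/
noncomputable def qdel (p x q y : ℝ) : ℝ := min (max (dem p y - q) 0) (x - q)

/-- Profit function. -/
noncomputable def profit (p c cm δ x q y : ℝ) : ℝ :=
  p * min (dem p y) (q + qdel p x q y) - cm * x - c * q - (c + δ) * qdel p x q y

/-- The mean-MAD ambiguity set: Borel probability measures on `ℝ` supported on
`[ylo, yhi]` with mean `μ` and mean absolute deviation `σ`. -/
def madSet (ylo yhi μ σ : ℝ) : Set (Measure ℝ) :=
  {Q | IsProbabilityMeasure Q ∧ Q (Set.Icc ylo yhi) = 1 ∧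
    (∫ y, y ∂Q) = μ ∧ (∫ y, |y - μ| ∂Q) = σ}

lemma profit_eq (p c cm δ x q y : ℝ) (hqx : q ≤ x) :
    profit p c cm δ x q y = (p - (c + δ)) * min (dem p y) x + (c + δ) * min (dem p y) q
      - cm * x - c * q := by
  unfold profit qdel
  generalize dem p y = d
  rcases le_total d q with h | h
  · have h' : d ≤ x := h.trans hqx
    rw [max_eq_right (by linarith), min_eq_left (by linarith : (0:ℝ) ≤ x - q),
      min_eq_left (by linarith), min_eq_left h', min_eq_left h]
    ring
  · rw [max_eq_left (by linarith)]
    rcases le_total d x with h' | h'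
    · rw [min_eq_left (by linarith : d - q ≤ x - q), min_eq_left (by linarith),
        min_eq_left h', min_eq_right h]
      ring
    · rw [min_eq_right (by linarith : x - q ≤ d - q), min_eq_right (by linarith),
        min_eq_right h', min_eq_right h]
      ring

lemma profit_cont (p c cm δ x q : ℝ) : Continuous (profit p c cm δ x q) := by
  unfold profit qdel dem
  fun_prop

lemma profit_concave (p c cm δ x q : ℝ) (hqx : q ≤ x) (h : 0 ≤ p - (c + δ)) (h' : 0 ≤ c + δ) :
    ∀ u v s t : ℝ, 0 ≤ s → 0 ≤ t → s + t = 1 →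
      s * profit p c cm δ x q u + t * profit p c cm δ x q v
        ≤ profit p c cm δ x q (s * u + t * v) := by
  intro u v s t hs ht hst
  have key : ∀ k, s * min (dem p u) k + t * min (dem p v) k ≤ min (dem p (s * u + t * v)) k := by
    intro k
    apply le_min
    · have e : dem p (s * u + t * v) = s * dem p u + t * dem p v := by unfold dem; ring
      rw [e]
      exact add_le_add (mul_le_mul_of_nonneg_left (min_le_left _ _) hs)
        (mul_le_mul_of_nonneg_left (min_le_left _ _) ht)
    · calc _ ≤ s * k + t * k := add_le_add (mul_le_mul_of_nonneg_left (min_le_right _ _) hs)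
            (mul_le_mul_of_nonneg_left (min_le_right _ _) ht)
        _ = k := by rw [← add_mul, hst, one_mul]
  simp only [profit_eq _ _ _ _ _ _ _ hqx]
  have k1 := mul_le_mul_of_nonneg_left (key x) h
  have k2 := mul_le_mul_of_nonneg_left (key q) h'
  have e : t = 1 - s := by linarith
  subst e
  linarith

lemma chord (f : ℝ → ℝ) (hf : ∀ u v s t : ℝ, 0 ≤ s → 0 ≤ t → s + t = 1 →
      s * f u + t * f v ≤ f (s * u + t * v)) (a b y : ℝ) (hab : a < b) (h1 : a ≤ y) (h2 : y ≤ b) :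
    f a + (f b - f a) / (b - a) * (y - a) ≤ f y := by
  have hb : 0 < b - a := by linarith
  have h := hf a b ((b - y) / (b - a)) ((y - a) / (b - a))
    (div_nonneg (by linarith) hb.le) (div_nonneg (by linarith) hb.le) (by field_simp; ring)
  have e : (b - y) / (b - a) * a + (y - a) / (b - a) * b = y := by field_simp; ring
  rw [e] at h
  refine le_trans (le_of_eq ?_) h
  field_simp
  ring

lemma int_three (a b e l m h : ℝ) (ha : 0 ≤ a) (hb : 0 ≤ b) (he : 0 ≤ e) (g : ℝ → ℝ) :
    ∫ y, g y ∂(ENNReal.ofReal a • Measure.dirac l +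
      ENNReal.ofReal b • Measure.dirac m + ENNReal.ofReal e • Measure.dirac h)
      = a * g l + b * g m + e * g h := by
  have I : ∀ (r z : ℝ), Integrable g (ENNReal.ofReal r • Measure.dirac z) := fun r z =>
    (integrable_dirac (by simp)).smul_measure ENNReal.ofReal_ne_top
  rw [integral_add_measure ((I _ _).add_measure (I _ _)) (I _ _),
    integral_add_measure (I _ _) (I _ _)]
  simp [integral_smul_measure, ENNReal.toReal_ofReal, ha, hb, he]

theorem stmt8
    (p c cm δ : ℝ) (hp0 : 0 < p) (hp1 : p < 1)
    (hc : 0 < c) (hcm : 0 < cm) (hδ : 0 ≤ δ) (hprof : c + δ + cm < p)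
    (ylo μ yhi σ : ℝ) (h1 : ylo < μ) (h2 : μ < yhi) (hσ : 0 < σ)
    (hfeas : σ / (2 * (μ - ylo)) + σ / (2 * (yhi - μ)) ≤ 1)
    (wlo wmu whi : ℝ)
    (hwlo : wlo = σ / (2 * (μ - ylo)))
    (hwhi : whi = σ / (2 * (yhi - μ)))
    (hwmu : wmu = 1 - wlo - whi)
    (Pstar : Measure ℝ)
    (hPstar : Pstar = ENNReal.ofReal wlo • Measure.dirac ylo +
      ENNReal.ofReal wmu • Measure.dirac μ + ENNReal.ofReal whi • Measure.dirac yhi)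
    (x q : ℝ) (hqx : q ≤ x) :
    sInf ((fun Q : Measure ℝ => ∫ y, profit p c cm δ x q y ∂Q) '' madSet ylo yhi μ σ) =
        wlo * profit p c cm δ x q ylo + wmu * profit p c cm δ x q μ +
          whi * profit p c cm δ x q yhi ∧
    Pstar ∈ madSet ylo yhi μ σ ∧
    (∫ y, profit p c cm δ x q y ∂Pstar) =
      wlo * profit p c cm δ x q ylo + wmu * profit p c cm δ x q μ +
        whi * profit p c cm δ x q yhi := by
  have hml : 0 < μ - ylo := by linarith
  have hmh : 0 < yhi - μ := by linarith
  have hl0 : 0 ≤ wlo := by rw [hwlo]; positivity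
  have hh0 : 0 ≤ whi := by rw [hwhi]; positivity
  have hm0 : 0 ≤ wmu := by rw [hwmu, hwlo, hwhi]; linarith
  have el : wlo * (μ - ylo) = σ / 2 := by rw [hwlo]; field_simp
  have eh : whi * (yhi - μ) = σ / 2 := by rw [hwhi]; field_simp
  have hthree := fun g => int_three wlo wmu whi ylo μ yhi hl0 hm0 hh0 g
  rw [← hPstar] at hthree
  have hmem : Pstar ∈ madSet ylo yhi μ σ := by
    have hsum : ENNReal.ofReal wlo + ENNReal.ofReal wmu + ENNReal.ofReal whi = 1 := by
      rw [← ENNReal.ofReal_add hl0 hm0, ← ENNReal.ofReal_add (by linarith) hh0, hwmu]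
      simp only [ENNReal.ofReal_eq_one]
      ring
    refine ⟨⟨?_⟩, ?_, ?_, ?_⟩
    · rw [hPstar]; simpa using hsum
    · rw [hPstar]
      have m1 : ylo ∈ Set.Icc ylo yhi := ⟨le_rfl, by linarith⟩
      have m2 : μ ∈ Set.Icc ylo yhi := ⟨h1.le, h2.le⟩
      have m3 : yhi ∈ Set.Icc ylo yhi := ⟨by linarith, le_rfl⟩
      simp only [Measure.add_apply, Measure.smul_apply, Measure.dirac_apply_of_mem m1,
        Measure.dirac_apply_of_mem m2, Measure.dirac_apply_of_mem m3, smul_eq_mul, mul_one]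
      exact hsum
    · rw [hthree fun y => y, hwmu]; linarith
    · rw [hthree fun y => |y - μ|, abs_of_neg (by linarith : ylo - μ < 0),
        abs_of_pos hmh, sub_self, abs_zero]
      linarith
  refine ⟨?_, hmem, hthree _⟩
  refine IsLeast.csInf_eq ⟨⟨Pstar, hmem, hthree _⟩, ?_⟩
  rintro _ ⟨Q, ⟨hQ, hs, hmean, hmad⟩, rfl⟩
  have hconc := profit_concave p c cm δ x q hqx (by linarith) (by linarith)
  have hcont := profit_cont p c cm δ x q
  change _ ≤ ∫ y, profit p c cm δ x q y ∂Q
  generalize profit p c cm δ x q = f at hconc hcont ⊢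
  have hae : ∀ᵐ y ∂Q, y ∈ Set.Icc ylo yhi := by
    rw [← prob_compl_eq_zero_iff measurableSet_Icc] at hs
    exact measure_eq_zero_iff_ae_notMem.mp hs |>.mono fun y hy => by simpa using hy
  have hI : ∀ g : ℝ → ℝ, Continuous g → Integrable g Q := by
    intro g hg
    have : Q.restrict (Set.Icc ylo yhi) = Q := Measure.restrict_eq_self_of_ae_mem hae
    rw [← this]
    exact hg.continuousOn.integrableOn_compact isCompact_Icc
  obtain ⟨sl, hsl⟩ : ∃ sl, sl = (f μ - f ylo) / (μ - ylo) := ⟨_, rfl⟩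
  obtain ⟨sh, hsh⟩ : ∃ sh, sh = (f yhi - f μ) / (yhi - μ) := ⟨_, rfl⟩
  have fl : f μ - f ylo = sl * (μ - ylo) := by rw [hsl]; field_simp
  have fh : f yhi - f μ = sh * (yhi - μ) := by rw [hsh]; field_simp
  have hle : ∀ᵐ y ∂Q, f μ + (sl + sh) / 2 * (y - μ) + (sh - sl) / 2 * |y - μ| ≤ f y := by
    filter_upwards [hae] with y hy
    rcases le_total y μ with h | h
    · have := chord f hconc ylo μ y h1 hy.1 h
      rw [← hsl] at this
      rw [abs_of_nonpos (by linarith)]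
      linarith
    · have := chord f hconc μ yhi y h2 h hy.2
      rw [← hsh] at this
      rw [abs_of_nonneg (by linarith)]
      linarith
  have hmono := integral_mono_ae (hI _ (by fun_prop)) (hI f hcont) hle
  rw [integral_add (hI _ (by fun_prop)) (hI _ (by fun_prop)),
    integral_add (hI _ (by fun_prop)) (hI _ (by fun_prop)), integral_const_mul,
    integral_const_mul, integral_sub (hI _ (by fun_prop)) (hI _ (by fun_prop)), hmean, hmad] at hmono
  simp only [integral_const, probReal_univ, one_smul] at hmono
  refine le_trans (le_of_eq ?_) hmono
  have e1 : f ylo = f μ - sl * (μ - ylo) := by linarith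
  have e2 : f yhi = f μ + sh * (yhi - μ) := by linarith
  rw [e1, e2, hwmu]
  linear_combination (-sl) * el + sh * eh
end

section
/- Suppose w_ȳ·δ < (w_y̲ + w_μ)·c and (w_μ + w_ȳ)·δ ≥ w_y̲·c. Then the maximizer of F over the six-point set S is as follows: (a) if c_m ≤ w_ȳ·(p − c − δ), then F(d_ȳ, d_μ) ≥ F(x, q) for all (x, q) ∈ S; (b) if w_ȳ·(p − c − δ) < c_m and c_m + c ≤ (w_μ + w_ȳ)·p, then F(d_μ, d_μ) ≥ F(x, q) for all (x, q) ∈ S; (c) if (w_μ + w_ȳ)·p < c_m + c, then F(d_y̲, d_y̲) ≥ F(x, q) for all (x, q) ∈ S. -/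
lemma profit_low (p c cm δ x q y : ℝ) (h : dem p y ≤ q) (hx : q ≤ x) :
    profit p c cm δ x q y = p * dem p y - cm * x - c * q := by
  have hq : qdel p x q y = 0 := by
    unfold qdel
    rw [max_eq_right (by linarith), min_eq_left (by linarith)]
  unfold profit
  rw [hq, min_eq_left (by linarith)]
  ring

lemma profit_mid (p c cm δ x q y : ℝ) (h : q ≤ dem p y) (hx : dem p y ≤ x) :
    profit p c cm δ x q y = p * dem p y - cm * x - c * q - (c + δ) * (dem p y - q) := by
  have hq : qdel p x q y = dem p y - q := by
    unfold qdel
    rw [max_eq_left (by linarith), min_eq_left (by linarith)]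
  unfold profit
  rw [hq, min_eq_left (by linarith)]

lemma profit_high (p c cm δ x q y : ℝ) (h : q ≤ x) (hx : x ≤ dem p y) :
    profit p c cm δ x q y = p * x - cm * x - c * q - (c + δ) * (x - q) := by
  have hq : qdel p x q y = x - q := by
    unfold qdel
    rw [max_eq_left (by linarith), min_eq_right (by linarith)]
  unfold profit
  rw [hq, min_eq_right (by linarith)]
  ring

theorem stmt13
    (p c cm δ : ℝ) (hp0 : 0 < p) (hp1 : p < 1)
    (hc : 0 < c) (hcm : 0 < cm) (hδ : 0 ≤ δ) (hprof : c + δ + cm < p)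
    (ylo μ yhi σ : ℝ) (h1 : ylo < μ) (h2 : μ < yhi) (hσ : 0 < σ)
    (hfeas : σ / (2 * (μ - ylo)) + σ / (2 * (yhi - μ)) ≤ 1)
    (wlo wmu whi : ℝ)
    (hwlo : wlo = σ / (2 * (μ - ylo)))
    (hwhi : whi = σ / (2 * (yhi - μ)))
    (hwmu : wmu = 1 - wlo - whi)
    (dlo dmu dhi : ℝ)
    (hdlo : dlo = (1 - p) * ylo) (hdmu : dmu = (1 - p) * μ) (hdhi : dhi = (1 - p) * yhi)
    (F : ℝ → ℝ → ℝ)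
    (hF : F = fun x q => wlo * profit p c cm δ x q ylo + wmu * profit p c cm δ x q μ +
      whi * profit p c cm δ x q yhi)
    (S : Set (ℝ × ℝ))
    (hS : S = {(dlo, dlo), (dmu, dlo), (dmu, dmu), (dhi, dlo), (dhi, dmu), (dhi, dhi)})
    (hcase1 : whi * δ < (wlo + wmu) * c) (hcase2 : (wmu + whi) * δ ≥ wlo * c) :
    (cm ≤ whi * (p - c - δ) → ∀ pq ∈ S, F dhi dmu ≥ F pq.1 pq.2) ∧
    (whi * (p - c - δ) < cm → cm + c ≤ (wmu + whi) * p → ∀ pq ∈ S, F dmu dmu ≥ F pq.1 pq.2) ∧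
    ((wmu + whi) * p < cm + c → ∀ pq ∈ S, F dlo dlo ≥ F pq.1 pq.2) := by
  have hwl : 0 < wlo := by rw [hwlo]; exact div_pos hσ (by linarith)
  have hwh : 0 < whi := by rw [hwhi]; exact div_pos hσ (by linarith)
  have hwm : 0 ≤ wmu := by rw [hwmu, hwlo, hwhi]; linarith
  have ha : dlo < dmu := by rw [hdlo, hdmu]; exact mul_lt_mul_of_pos_left h1 (by linarith)
  have hb : dmu < dhi := by rw [hdmu, hdhi]; exact mul_lt_mul_of_pos_left h2 (by linarith)
  have el : dem p ylo = dlo := hdlo.symm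
  have em : dem p μ = dmu := hdmu.symm
  have eh : dem p yhi = dhi := hdhi.symm
  have hwl' : wlo = 1 - wmu - whi := by linarith
  clear hwlo hwhi hwmu hfeas
  have F1 : F dlo dlo = (p - c - cm) * dlo := by
    simp only [hF]
    rw [profit_low _ _ _ _ _ _ ylo (by linarith) (by linarith),
      profit_high _ _ _ _ _ _ μ (by linarith) (by linarith),
      profit_high _ _ _ _ _ _ yhi (by linarith) (by linarith), el, hwl']
    ring
  have F2 : F dmu dlo = F dlo dlo + (dmu - dlo) * ((wmu + whi) * (p - c - δ) - cm) := by
    rw [F1]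
    simp only [hF]
    rw [profit_low _ _ _ _ _ _ ylo (by linarith) (by linarith),
      profit_high _ _ _ _ _ _ μ (by linarith) (by linarith),
      profit_high _ _ _ _ _ _ yhi (by linarith) (by linarith), el, hwl']
    ring
  have F3 : F dmu dmu = F dlo dlo + (dmu - dlo) * ((wmu + whi) * p - c - cm) := by
    rw [F1]
    simp only [hF]
    rw [profit_low _ _ _ _ _ _ ylo (by linarith) (by linarith),
      profit_low _ _ _ _ _ _ μ (by linarith) (by linarith),
      profit_high _ _ _ _ _ _ yhi (by linarith) (by linarith), el, em, hwl']
    ring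
  have F4 : F dhi dlo = F dmu dlo + (dhi - dmu) * (whi * (p - c - δ) - cm) := by
    rw [F2, F1]
    simp only [hF]
    rw [profit_low _ _ _ _ _ _ ylo (by linarith) (by linarith),
      profit_mid _ _ _ _ _ _ μ (by linarith) (by linarith),
      profit_high _ _ _ _ _ _ yhi (by linarith) (by linarith), el, em, hwl']
    ring
  have F5 : F dhi dmu = F dmu dmu + (dhi - dmu) * (whi * (p - c - δ) - cm) := by
    rw [F3, F1]
    simp only [hF]
    rw [profit_low _ _ _ _ _ _ ylo (by linarith) (by linarith),
      profit_low _ _ _ _ _ _ μ (by linarith) (by linarith),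
      profit_high _ _ _ _ _ _ yhi (by linarith) (by linarith), el, em, hwl']
    ring
  have F6 : F dhi dhi = F dmu dmu + (dhi - dmu) * (whi * p - c - cm) := by
    rw [F3, F1]
    simp only [hF]
    rw [profit_low _ _ _ _ _ _ ylo (by linarith) (by linarith),
      profit_low _ _ _ _ _ _ μ (by linarith) (by linarith),
      profit_low _ _ _ _ _ _ yhi (by linarith) (by linarith), el, em, eh, hwl']
    ring
  -- comparison of the slopes
  have k1 : (wmu + whi) * (p - c - δ) - cm ≤ (wmu + whi) * p - c - cm := by
    rw [hwl'] at hcase2; linarith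
  have k2 : whi * p - c - cm ≤ whi * (p - c - δ) - cm := by
    rw [hwl'] at hcase1; linarith
  have k3 : whi * (p - c - δ) - cm ≤ (wmu + whi) * (p - c - δ) - cm := by
    have := mul_nonneg hwm (by linarith : 0 ≤ p - c - δ)
    linarith
  have g1 : F dmu dlo ≤ F dmu dmu := by
    have := mul_le_mul_of_nonneg_left k1 (by linarith : 0 ≤ dmu - dlo)
    linarith
  have g2 : F dhi dhi ≤ F dhi dmu := by
    have := mul_le_mul_of_nonneg_left k2 (by linarith : 0 ≤ dhi - dmu)
    linarith
  have fin : ∀ M : ℝ, F dlo dlo ≤ M → F dmu dmu ≤ M → F dhi dmu ≤ M →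
      ∀ pq ∈ S, M ≥ F pq.1 pq.2 := by
    intro M m1 m2 m3 pq hpq
    rw [hS] at hpq
    simp only [Set.mem_insert_iff, Set.mem_singleton_iff] at hpq
    rcases hpq with rfl | rfl | rfl | rfl | rfl | rfl <;> dsimp only <;> linarith
  refine ⟨fun h => ?_, fun h h' => ?_, fun h => ?_⟩
  · have t1 := mul_nonneg (by linarith : 0 ≤ dhi - dmu)
      (by linarith : 0 ≤ whi * (p - c - δ) - cm)
    have t2 := mul_nonneg (by linarith : 0 ≤ dmu - dlo)
      (by linarith : 0 ≤ (wmu + whi) * p - c - cm)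
    apply fin <;> linarith
  · have t1 := mul_nonneg (by linarith : 0 ≤ dhi - dmu)
      (by linarith : 0 ≤ -(whi * (p - c - δ) - cm))
    have t2 := mul_nonneg (by linarith : 0 ≤ dmu - dlo)
      (by linarith : 0 ≤ (wmu + whi) * p - c - cm)
    apply fin <;> linarith
  · have t1 := mul_nonneg (by linarith : 0 ≤ dhi - dmu)
      (by linarith : 0 ≤ -(whi * (p - c - δ) - cm))
    have t2 := mul_nonneg (by linarith : 0 ≤ dmu - dlo)
      (by linarith : 0 ≤ -((wmu + whi) * p - c - cm))
    apply fin <;> linarith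
end
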